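/- Let κ₁ : [0,∞) → [0,∞) be continuous, nondecreasing, with κ₁(0) = 0, κ₁(q) > 0 for q > 0 and ∫₀₊ dq/κ₁(q) = ∞. Let C₃ > 0 and T₁ > 0 be such that κ₁(C₃·t) ≤ C₃ for all t ∈ [0,T₁]. Define φ₁(t) = C₃·t and φ_{n+1}(t) = ∫₀ᵗ κ₁(φ_n(s)) ds for n ≥ 1. Then lim_{n→∞} φ_n(t) = 0 for every t ∈ [0,T₁]. -/

import Mathlib

open Set MeasureTheory intervalIntegral Filter

/-- The Picard-type iterates `φ₁(t) = C₃ t`, `φ_{n+1}(t) = ∫₀ᵗ κ₁(φ_n(s)) ds`.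
Here `phi κ₁ C₃ n` denotes `φ_{n+1}`, so `phi κ₁ C₃ 0 = φ₁`. -/
noncomputable def phi (κ₁ : ℝ → ℝ) (C₃ : ℝ) : ℕ → ℝ → ℝ
  | 0 => fun t => C₃ * t
  | n + 1 => fun t => ∫ s in (0 : ℝ)..t, κ₁ (phi κ₁ C₃ n s)

/-- A nonnegative solution of `φ(t) = ∫₀ᵗ κ(φ(s)) ds` vanishes when `κ` satisfies Osgood's
condition at zero. -/
theorem eq_zero_of_osgood {κ φ : ℝ → ℝ} {T : ℝ}
    (hκ_cont : ContinuousOn κ (Ici 0))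
    (hκ_pos : ∀ q > (0 : ℝ), 0 < κ q)
    (hκ_int : ∀ ε > (0 : ℝ), ∫⁻ q in Ioo (0 : ℝ) ε, ENNReal.ofReal (1 / κ q) = ⊤)
    (hφ_nonneg : ∀ t ∈ Icc (0 : ℝ) T, 0 ≤ φ t)
    (hint : IntegrableOn (fun s => κ (φ s)) (Icc 0 T))
    (hφ : ∀ t ∈ Icc (0 : ℝ) T, φ t = ∫ s in (0 : ℝ)..t, κ (φ s)) :
    ∀ t ∈ Icc (0 : ℝ) T, φ t = 0 := by
  intro b hb
  by_contra hne
  have hbpos : 0 < φ b := lt_of_le_of_ne (hφ_nonneg b hb) (Ne.symm hne)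
  have hT : 0 ≤ T := hb.1.trans hb.2
  have hφ_cont : ContinuousOn φ (Icc 0 T) := by
    have h := continuousOn_primitive_interval (f := fun s => κ (φ s)) (μ := volume)
      (a := 0) (b := T) (by rwa [uIcc_of_le hT])
    rw [uIcc_of_le hT] at h
    exact h.congr hφ
  have hκφ_cont : ContinuousOn (fun s => κ (φ s)) (Icc 0 T) := hκ_cont.comp hφ_cont hφ_nonneg
  have hderiv : ∀ x ∈ Ioo 0 T, HasDerivAt φ (κ (φ x)) x := by
    intro x hx
    have hxT : x ∈ Icc 0 T := Ioo_subset_Icc_self hx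
    have h : HasDerivAt (fun u => ∫ s in (0 : ℝ)..u, κ (φ s)) (κ (φ x)) x := by
      refine integral_hasDerivAt_right ?_ ?_ ?_
      · rw [intervalIntegrable_iff_integrableOn_Icc_of_le hx.1.le]
        exact hint.mono_set (Icc_subset_Icc_right hx.2.le)
      · exact (hκφ_cont.mono Ioo_subset_Icc_self).stronglyMeasurableAtFilter isOpen_Ioo x hx
      · exact hκφ_cont.continuousAt (Icc_mem_nhds hx.1 hx.2)
    refine h.congr_of_eventuallyEq ?_
    filter_upwards [Icc_mem_nhds hx.1 hx.2] with y hy using hφ y hy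
  have hsub : Icc 0 b ⊆ Icc 0 T := Icc_subset_Icc_right hb.2
  have hzero : φ 0 = 0 := by simpa using hφ 0 ⟨le_rfl, hT⟩
  obtain ⟨a, ⟨haI, ha0⟩, hamax⟩ :
      ∃ a, IsGreatest (Icc 0 b ∩ φ ⁻¹' {0}) a := by
    refine IsCompact.exists_isGreatest ?_ ⟨0, ⟨le_rfl, hb.1⟩, hzero⟩
    exact isCompact_Icc.of_isClosed_subset
      ((hφ_cont.mono hsub).preimage_isClosed_of_isClosed isClosed_Icc isClosed_singleton)
      inter_subset_left
  have ha0 : φ a = 0 := ha0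
  have hab : a ≤ b := haI.2
  have hIoo : Ioo a b ⊆ Ioo 0 T := Ioo_subset_Ioo haI.1 hb.2
  have hpos : ∀ x ∈ Ioo a b, 0 < φ x := by
    intro x hx
    have hxI : x ∈ Icc 0 b := ⟨haI.1.trans hx.1.le, hx.2.le⟩
    refine lt_of_le_of_ne (hφ_nonneg x (hsub hxI)) fun h => ?_
    exact hx.1.not_ge (hamax ⟨hxI, h.symm⟩)
  have hcont : ContinuousOn φ (Icc a b) := hφ_cont.mono (Icc_subset_Icc haI.1 hb.2)
  have hmono : StrictMonoOn φ (Icc a b) := by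
    refine strictMonoOn_of_deriv_pos (convex_Icc a b) hcont fun x hx => ?_
    rw [interior_Icc] at hx
    rw [(hderiv x (hIoo hx)).deriv]
    exact hκ_pos _ (hpos x hx)
  have himage : Ioo 0 (φ b) ⊆ φ '' Ioo a b := by
    simpa only [ha0] using intermediate_value_Ioo hab hcont
  have hchange := lintegral_image_eq_lintegral_abs_deriv_mul (s := Ioo a b) measurableSet_Ioo
    (fun x hx => (hderiv x (hIoo hx)).hasDerivWithinAt)
    (hmono.injOn.mono Ioo_subset_Icc_self) (fun q => ENNReal.ofReal (1 / κ q))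
  have hone : ∫⁻ x in Ioo a b, ENNReal.ofReal |κ (φ x)| * ENNReal.ofReal (1 / κ (φ x))
      = ∫⁻ _ in Ioo a b, 1 := by
    refine setLIntegral_congr_fun measurableSet_Ioo fun x hx => ?_
    have hκx := hκ_pos _ (hpos x hx)
    rw [← ENNReal.ofReal_mul (abs_nonneg _), abs_of_pos hκx, mul_one_div_cancel hκx.ne',
      ENNReal.ofReal_one]
  have htop : (⊤ : ENNReal) ≤ ENNReal.ofReal (b - a) := by
    calc (⊤ : ENNReal) = ∫⁻ q in Ioo 0 (φ b), ENNReal.ofReal (1 / κ q) :=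
          (hκ_int _ hbpos).symm
      _ ≤ ∫⁻ q in φ '' Ioo a b, ENNReal.ofReal (1 / κ q) := lintegral_mono_set himage
      _ = ENNReal.ofReal (b - a) := by rw [hchange, hone]; simp
  exact ENNReal.ofReal_ne_top (top_le_iff.1 htop)

theorem MonotoneOn.intervalIntegrable_of_mem_Icc {f : ℝ → ℝ} {T a b : ℝ}
    (hf : MonotoneOn f (Icc 0 T)) (ha : a ∈ Icc 0 T) (hb : b ∈ Icc 0 T) :
    IntervalIntegrable f volume a b :=
  (hf.mono (uIcc_subset_Icc ha hb)).intervalIntegrable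

theorem phi_nonneg_and_monotoneOn {κ : ℝ → ℝ} {C T : ℝ}
    (hκ_mono : MonotoneOn κ (Ici 0)) (hκ0 : 0 ≤ κ 0) (hC : 0 ≤ C) (n : ℕ) :
    (∀ t ∈ Icc (0 : ℝ) T, 0 ≤ phi κ C n t) ∧ MonotoneOn (phi κ C n) (Icc 0 T) := by
  induction n with
  | zero =>
    exact ⟨fun t ht => mul_nonneg hC ht.1, fun s _ t _ hst => mul_le_mul_of_nonneg_left hst hC⟩
  | succ n ih =>
    obtain ⟨hnonneg, hmono⟩ := ih
    have hκφ : MonotoneOn (fun s => κ (phi κ C n s)) (Icc 0 T) := hκ_mono.comp hmono hnonneg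
    have hpos : ∀ s ∈ Icc (0 : ℝ) T, 0 ≤ κ (phi κ C n s) := fun s hs =>
      hκ0.trans (hκ_mono self_mem_Ici (hnonneg s hs) (hnonneg s hs))
    refine ⟨fun t ht => integral_nonneg ht.1 fun s hs => hpos s ⟨hs.1, hs.2.trans ht.2⟩,
      fun s hs t ht hst => ?_⟩
    have h0 : (0 : ℝ) ∈ Icc 0 T := ⟨le_rfl, hs.1.trans hs.2⟩
    have hsplit := integral_add_adjacent_intervals
      (hκφ.intervalIntegrable_of_mem_Icc h0 hs) (hκφ.intervalIntegrable_of_mem_Icc hs ht)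
    have hnn : 0 ≤ ∫ u in s..t, κ (phi κ C n u) :=
      integral_nonneg hst fun u hu => hpos u ⟨hs.1.trans hu.1, hu.2.trans ht.2⟩
    simp only [phi]
    linarith

theorem phi_succ_le {κ : ℝ → ℝ} {C T : ℝ}
    (hκ_mono : MonotoneOn κ (Ici 0)) (hκ0 : 0 ≤ κ 0) (hC : 0 ≤ C)
    (hbound : ∀ t ∈ Icc (0 : ℝ) T, κ (C * t) ≤ C) (n : ℕ) :
    ∀ t ∈ Icc (0 : ℝ) T, phi κ C (n + 1) t ≤ phi κ C n t := by
  have hint (m : ℕ) {t : ℝ} (ht : t ∈ Icc 0 T) :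
      IntervalIntegrable (fun s => κ (phi κ C m s)) volume 0 t :=
    have h := phi_nonneg_and_monotoneOn (T := T) hκ_mono hκ0 hC m
    MonotoneOn.intervalIntegrable_of_mem_Icc (hκ_mono.comp h.2 h.1)
      ⟨le_rfl, ht.1.trans ht.2⟩ ht
  induction n with
  | zero =>
    intro t ht
    have h : ∫ s in (0 : ℝ)..t, κ (phi κ C 0 s) ≤ ∫ _ in (0 : ℝ)..t, C :=
      integral_mono_on ht.1 (hint 0 ht) intervalIntegrable_const
        fun s hs => hbound s ⟨hs.1, hs.2.trans ht.2⟩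
    simpa [phi, mul_comm] using h
  | succ n ih =>
    intro t ht
    refine integral_mono_on ht.1 (hint (n + 1) ht) (hint n ht) fun s hs => ?_
    have hsT : s ∈ Icc 0 T := ⟨hs.1, hs.2.trans ht.2⟩
    exact hκ_mono ((phi_nonneg_and_monotoneOn hκ_mono hκ0 hC (n + 1)).1 s hsT)
      ((phi_nonneg_and_monotoneOn hκ_mono hκ0 hC n).1 s hsT) (ih s hsT)

/-- If moreover `κ₁(0) = 0`, `κ₁(q) > 0` for `q > 0`, and `∫₀₊ dq/κ₁(q) = ∞`,
then `φ_n(t) → 0` as `n → ∞`, for every `t ∈ [0,T₁]`. -/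
theorem phi_tendsto_zero
    (κ₁ : ℝ → ℝ)
    (hκ₁_cont : ContinuousOn κ₁ (Ici 0))
    (hκ₁_mono : MonotoneOn κ₁ (Ici 0))
    (hκ₁0 : κ₁ 0 = 0)
    (hκ₁_pos : ∀ q > (0 : ℝ), 0 < κ₁ q)
    (hκ₁_int : ∀ ε > (0 : ℝ), ∫⁻ q in Ioo (0 : ℝ) ε, ENNReal.ofReal (1 / κ₁ q) = ⊤)
    (C₃ T₁ : ℝ) (hC₃ : 0 < C₃) (hT₁ : 0 < T₁)
    (hbound : ∀ t ∈ Icc (0 : ℝ) T₁, κ₁ (C₃ * t) ≤ C₃) :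
    ∀ t ∈ Icc (0 : ℝ) T₁,
      Tendsto (fun n : ℕ => phi κ₁ C₃ n t) atTop (nhds 0) := by
  have hC := hC₃.le
  have hκ0 : 0 ≤ κ₁ 0 := hκ₁0.ge
  have hphi := phi_nonneg_and_monotoneOn (T := T₁) hκ₁_mono hκ0 hC
  have hanti : ∀ t ∈ Icc (0 : ℝ) T₁, Antitone fun n => phi κ₁ C₃ n t := fun t ht =>
    antitone_nat_of_succ_le fun n => phi_succ_le hκ₁_mono hκ0 hC hbound n t ht
  set φ : ℝ → ℝ := fun t => ⨅ n, phi κ₁ C₃ n t with hφ_def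
  have hlim : ∀ t ∈ Icc (0 : ℝ) T₁, Tendsto (fun n => phi κ₁ C₃ n t) atTop (nhds (φ t)) := by
    intro t ht
    refine tendsto_atTop_ciInf (hanti t ht) ⟨0, ?_⟩
    rintro _ ⟨n, rfl⟩
    exact (hphi n).1 t ht
  have hφ_nonneg : ∀ t ∈ Icc (0 : ℝ) T₁, 0 ≤ φ t := fun t ht =>
    ge_of_tendsto' (hlim t ht) fun n => (hphi n).1 t ht
  have hφ_mono : MonotoneOn φ (Icc 0 T₁) := fun s hs t ht hst =>
    le_of_tendsto_of_tendsto' (hlim s hs) (hlim t ht) fun n => (hphi n).2 hs ht hst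
  have hint : IntegrableOn (fun s => κ₁ (φ s)) (Icc 0 T₁) :=
    (show MonotoneOn (fun s => κ₁ (φ s)) (Icc 0 T₁) from
      hκ₁_mono.comp hφ_mono hφ_nonneg).integrableOn_isCompact isCompact_Icc
  have hφ_eq : ∀ t ∈ Icc (0 : ℝ) T₁, φ t = ∫ s in (0 : ℝ)..t, κ₁ (φ s) := by
    intro t ht
    have hmem : ∀ s ∈ Set.uIoc 0 t, s ∈ Icc 0 T₁ := by
      intro s hs
      rw [uIoc_of_le ht.1] at hs
      exact ⟨hs.1.le, hs.2.trans ht.2⟩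
    refine tendsto_nhds_unique ((tendsto_add_atTop_iff_nat 1).2 (hlim t ht)) ?_
    refine tendsto_integral_filter_of_dominated_convergence (fun _ => C₃)
      (Eventually.of_forall fun n => ?_) (Eventually.of_forall fun n => ?_)
      intervalIntegrable_const ?_
    · exact (MonotoneOn.intervalIntegrable_of_mem_Icc
        (hκ₁_mono.comp (hphi n).2 (hphi n).1)
        ⟨le_rfl, hT₁.le⟩ ht).aestronglyMeasurable_restrict_uIoc
    · refine ae_of_all _ fun s hs => ?_
      have hsT := hmem s hs
      have h0 := (hphi n).1 s hsT
      rw [Real.norm_of_nonneg (hκ0.trans (hκ₁_mono self_mem_Ici h0 h0))]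
      exact (hκ₁_mono h0 ((hphi 0).1 s hsT) (hanti s hsT n.zero_le)).trans (hbound s hsT)
    · refine ae_of_all _ fun s hs => ?_
      have hsT := hmem s hs
      exact (hκ₁_cont (φ s) (hφ_nonneg s hsT)).tendsto.comp
        (tendsto_nhdsWithin_iff.2 ⟨hlim s hsT, Eventually.of_forall fun n => (hphi n).1 s hsT⟩)
  intro t ht
  have h := hlim t ht
  rwa [eq_zero_of_osgood hκ₁_cont hκ₁_pos hκ₁_int hφ_nonneg hint hφ_eq t ht] at h
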